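/- arXiv:1105.0142 — 4 statements merged into one kernel-verified Lean document; each statement's English description precedes it below -/
import Mathlib

section
/- Let D be an integral domain with quotient field K ≠ D, and suppose there is a set 𝒮 of prime ideals of D such that D = ⋂_{p ∈ 𝒮} D_p (intersection inside K) and every nonzero element of D is a unit in D_p for all but finitely many p ∈ 𝒮. Then for every multiplicative subset S of D with 0 ∉ S one has Int(S⁻¹D) = S⁻¹Int(D), where S⁻¹D is viewed as a subring of K and S⁻¹Int(D) = {f/s : f ∈ Int(D), s ∈ S} ⊆ K[X]. -/
namespace IVP

open Polynomial

variable {F : Type} [Field F]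

/-- Integer-valued polynomials on the set `E` with values in `D`:
`Int(E,D) = {f ∈ F[X] : f(E) ⊆ D}`. -/
def IntOn (E D : Set F) : Set (Polynomial F) := {f | ∀ x ∈ E, f.eval x ∈ D}

/-- `Int(D) = {f ∈ F[X] : f(D) ⊆ D}`. -/
def IntR (D : Set F) : Set (Polynomial F) := IntOn D D

/-- Polynomials with all coefficients in `R`, i.e. `R[X]` as a subset of `F[X]`. -/
def polySet (R : Set F) : Set (Polynomial F) := {f | ∀ n, f.coeff n ∈ R}

/-- `I⁻¹ = (D :_K I) = {x : x·I ⊆ D}`. -/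
def dinv (D I : Set F) : Set F := {x | ∀ y ∈ I, x * y ∈ D}

/-- `I_v = (I⁻¹)⁻¹`. -/
def dv (D I : Set F) : Set F := dinv D (dinv D I)

/-- `I_t = ⋃ J_v`, the union over all nonzero finitely generated fractional ideals
`J ⊆ I`; such a `J` is the `D`-span of a finite set `T ⊆ I` containing a nonzero
element, and `J_v` depends only on `T`. -/
def dt (D I : Set F) : Set F :=
  {x | ∃ T : Finset F, ↑T ⊆ I ∧ (∃ y ∈ T, y ≠ 0) ∧ x ∈ dv D ↑T}

/-- The image in `F` of a set of elements of the subring `D`. -/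
def iset (D : Subring F) (I : Set ↥D) : Set F := (↑) '' I

/-- `I` is a t-ideal: `I_t = I`. -/
def IsTIdeal (D I : Set F) : Prop := dt D I = I

/-- `I` is a v-ideal: `I_v = I`. -/
def IsVIdeal (D I : Set F) : Prop := dv D I = I

/-- `p` is a t-maximal ideal of `D`: maximal among the t-ideals properly contained
in `D`. -/
def IsTMax (D : Subring F) (p : Ideal ↥D) : Prop :=
  p ≠ ⊤ ∧ IsTIdeal ↑D (iset D ↑p) ∧
    ∀ q : Ideal ↥D, q ≠ ⊤ → IsTIdeal ↑D (iset D ↑q) → p ≤ q → p = q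

/-- `p` is a v-maximal ideal of `D`: maximal among the v-ideals properly contained
in `D`. -/
def IsVMax (D : Subring F) (p : Ideal ↥D) : Prop :=
  p ≠ ⊤ ∧ IsVIdeal ↑D (iset D ↑p) ∧
    ∀ q : Ideal ↥D, q ≠ ⊤ → IsVIdeal ↑D (iset D ↑q) → p ≤ q → p = q

/-- The localization `S⁻¹D` of `D` at a multiplicative subset `S ⊆ D`, as a subset
of `F`. -/
def mlocSet (D : Subring F) (S : Set ↥D) : Set F :=
  {x | ∃ a : ↥D, ∃ s ∈ S, (s : F) * x = (a : F)}

/-- The localization `D_p` of `D` at the complement of `p`, as a subset of `F`. -/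
def plocSet (D : Subring F) (p : Ideal ↥D) : Set F := mlocSet D {s | s ∉ p}

/-- The localization `S⁻¹R` of a set `R` of polynomials at a multiplicative subset
`S ⊆ D`, as a subset of `F[X]`. -/
def mlocPoly (D : Subring F) (S : Set ↥D) (R : Set (Polynomial F)) : Set (Polynomial F) :=
  {f | ∃ g ∈ R, ∃ s ∈ S, C (s : F) * f = g}

/-- The localization `R_p` of a set `R` of polynomials at `D ∖ p`. -/
def plocPoly (D : Subring F) (p : Ideal ↥D) (R : Set (Polynomial F)) : Set (Polynomial F) :=
  mlocPoly D {s | s ∉ p} R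

/-- The ideal `pD_p` of the localization `D_p`, as a subset of `F`. -/
def plocIdl (D : Subring F) (p : Ideal ↥D) : Set F :=
  {x | ∃ y ∈ p, ∃ s : ↥D, s ∉ p ∧ (s : F) * x = ((y : ↥D) : F)}

/-- `p` is t-localizing: `pD_p` is a t-ideal of `D_p`. -/
def TLocalizing (D : Subring F) (p : Ideal ↥D) : Prop :=
  IsTIdeal (plocSet D p) (plocIdl D p)

/-- `F` is the quotient field of `D`. -/
def IsQuotField (D : Subring F) : Prop :=
  ∀ x : F, ∃ a b : ↥D, b ≠ 0 ∧ (b : F) * x = (a : F)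

/-- The quotient field of `D`, as a subset of the ambient field. -/
def fracSet (D : Subring F) : Set F :=
  {x | ∃ a b : ↥D, b ≠ 0 ∧ (b : F) * x = (a : F)}

/-- The conductor ideal `(aD :_D bD) = {d ∈ D : d·b ∈ aD}` of `D`. -/
def Conductor (D : Subring F) (a b : ↥D) : Set ↥D := {d | ∃ c : ↥D, d * b = a * c}

/-- Elementwise product of two subsets of `F`. -/
def setMul (A B : Set F) : Set F := {z | ∃ x ∈ A, ∃ y ∈ B, z = x * y}

/-- The ideal `I` of `D` is t-invertible: `(I⁻¹I)_t = D`. -/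
def TInv (D : Subring F) (I : Ideal ↥D) : Prop :=
  dt ↑D (setMul (dinv ↑D (iset D ↑I)) (iset D ↑I)) = (↑D : Set F)

/-- The ideal `I` of `D` is v-invertible: `(I⁻¹I)_v = D`. -/
def VInv (D : Subring F) (I : Ideal ↥D) : Prop :=
  dv ↑D (setMul (dinv ↑D (iset D ↑I)) (iset D ↑I)) = (↑D : Set F)

/-- `D` is a PVMD: every nonzero finitely generated ideal of `D` is t-invertible. -/
def IsPVMD (D : Subring F) : Prop :=
  ∀ I : Ideal ↥D, I ≠ ⊥ → I.FG → TInv D I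

/-- `D` is an H domain: every v-invertible nonzero ideal of `D` is t-invertible. -/
def IsHDomain (D : Subring F) : Prop :=
  ∀ I : Ideal ↥D, I ≠ ⊥ → VInv D I → TInv D I

/-- `p ∈ sKr(K/D)`: `p` is a prime such that every finitely generated ideal
`I ⊆ p` satisfies `I ⊆ J ⊆ p` for some conductor ideal `J` of `D`. -/
def SKrMem (D : Subring F) (p : Ideal ↥D) : Prop :=
  p.IsPrime ∧ ∀ I : Ideal ↥D, I.FG → I ≤ p →
    ∃ a b : ↥D, a ≠ 0 ∧ (↑I : Set ↥D) ⊆ Conductor D a b ∧ Conductor D a b ⊆ ↑p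

/-- The localization `A_p` of `A ⊇ D` at the complement in `D` of a prime `p` of `D`,
as a subset of the ambient field. -/
def mixedLocSet (D A : Subring F) (p : Ideal ↥D) : Set F :=
  {x | ∃ a : ↥A, ∃ s : ↥D, s ∉ p ∧ (s : F) * x = (a : F)}

/-- `pD_p` is a principal ideal of `D_p`. -/
def PLocPrincipal (D : Subring F) (p : Ideal ↥D) : Prop :=
  ∃ g : F, plocIdl D p = {x | ∃ d ∈ plocSet D p, x = d * g}

/-- The localization `A_p` of `A ⊇ D` at a prime `p` of `D`, as a subring of the
ambient field. -/
def mixedLoc (D A : Subring F) (hDA : D ≤ A) (p : Ideal ↥D) (hp : p.IsPrime) :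
    Subring F where
  carrier := mixedLocSet D A p
  one_mem' := ⟨1, 1, fun h => hp.ne_top (Ideal.eq_top_of_isUnit_mem p h isUnit_one), by simp⟩
  zero_mem' := ⟨0, 1, fun h => hp.ne_top (Ideal.eq_top_of_isUnit_mem p h isUnit_one), by simp⟩
  mul_mem' := by
    rintro x y ⟨a, s, hs, hx⟩ ⟨b, t, ht, hy⟩
    refine ⟨a * b, s * t, fun h => ((hp.mem_or_mem h).elim hs ht), ?_⟩
    push_cast
    rw [mul_mul_mul_comm, hx, hy]
  add_mem' := by
    rintro x y ⟨a, s, hs, hx⟩ ⟨b, t, ht, hy⟩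
    refine ⟨⟨t, hDA t.2⟩ * a + ⟨s, hDA s.2⟩ * b, s * t,
      fun h => ((hp.mem_or_mem h).elim hs ht), ?_⟩
    push_cast
    rw [mul_add]
    rw [show ((s:F) * t) * x = (t:F) * ((s:F) * x) by ring, hx,
      show ((s:F) * t) * y = (s:F) * ((t:F) * y) by ring, hy]
  neg_mem' := by
    rintro x ⟨a, s, hs, hx⟩
    exact ⟨-a, s, hs, by push_cast; rw [mul_neg, hx]⟩

/-- The localization `D_p` of `D` at a prime `p`, as a subring of `F`. -/
def primeLoc (D : Subring F) (p : Ideal ↥D) (hp : p.IsPrime) : Subring F :=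
  mixedLoc D D le_rfl p hp

/-- `Int(D)` as a subring of `F[X]`. -/
def IntSubring (D : Subring F) : Subring (Polynomial F) where
  carrier := IntR ↑D
  one_mem' := fun x _ => by simpa using D.one_mem
  zero_mem' := fun x _ => by simpa using D.zero_mem
  mul_mem' := fun hf hg x hx => by
    rw [eval_mul]; exact D.mul_mem (hf x hx) (hg x hx)
  add_mem' := fun hf hg x hx => by
    rw [eval_add]; exact D.add_mem (hf x hx) (hg x hx)
  neg_mem' := fun hf x hx => by
    rw [eval_neg]; exact D.neg_mem (hf x hx)

/-- `Int(D)` as a `D`-submodule of `F[X]`. -/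
def intSubmodule (D : Subring F) : Submodule ↥D (Polynomial F) where
  carrier := IntR ↑D
  zero_mem' := fun x _ => by simpa using D.zero_mem
  add_mem' := fun hf hg x hx => by
    rw [eval_add]; exact D.add_mem (hf x hx) (hg x hx)
  smul_mem' := fun c f hf x hx => by
    have h : c • f = C (c : F) * f := by
      rw [Algebra.smul_def]; rfl
    rw [h, eval_mul, eval_C]
    exact D.mul_mem c.2 (hf x hx)

/-- An overring `D'` of `D` as a `D`-submodule of `F`. -/
def subringSubmodule (D D' : Subring F) (h : D ≤ D') : Submodule ↥D F where
  carrier := ↑D'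
  zero_mem' := D'.zero_mem
  add_mem' := fun ha hb => D'.add_mem ha hb
  smul_mem' := fun c x hx => by
    rw [Subring.smul_def]
    exact D'.mul_mem (h c.2) hx

/-- `Int(D)_p` as a `D_p`-submodule of `F[X]`. -/
def plocIntSubmodule (D : Subring F) (p : Ideal ↥D) (hp : p.IsPrime) :
    Submodule ↥(primeLoc D p hp) (Polynomial F) where
  carrier := plocPoly D p (IntR ↑D)
  zero_mem' :=
    ⟨0, fun x _ => by simpa using D.zero_mem, 1,
      fun h => hp.ne_top (Ideal.eq_top_of_isUnit_mem p h isUnit_one), by simp⟩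
  add_mem' := by
    rintro f f' ⟨g, hg, s, hs, hfg⟩ ⟨g', hg', t, ht, hfg'⟩
    refine ⟨C (t : F) * g + C (s : F) * g', ?_, s * t,
      fun h => ((hp.mem_or_mem h).elim hs ht), ?_⟩
    · intro x hx
      rw [eval_add, eval_mul, eval_mul, eval_C, eval_C]
      exact D.add_mem (D.mul_mem t.2 (hg x hx)) (D.mul_mem s.2 (hg' x hx))
    · rw [← hfg, ← hfg']
      push_cast
      rw [map_mul]
      ring
  smul_mem' := by
    rintro c f ⟨g, hg, t, ht, hfg⟩
    obtain ⟨a, s, hs, hsc⟩ := c.2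
    have h : c • f = C (c : F) * f := by rw [Algebra.smul_def]; rfl
    refine ⟨C (a : F) * g, ?_, s * t,
      fun hmem => ((hp.mem_or_mem hmem).elim hs ht), ?_⟩
    · intro x hx
      rw [eval_mul, eval_C]
      exact D.mul_mem a.2 (hg x hx)
    · rw [h, ← hfg, ← hsc]
      push_cast
      rw [map_mul, map_mul]
      ring

section Extensions

variable {L : Type} [Field L]

/-- The data of an extension: the subring `A` of `L` contains the image of `D`
under the embedding `φ` of quotient fields. -/
def ExtMem (D : Subring F) (φ : F →+* L) (A : Subring L) : Prop := ∀ d : ↥D, φ d ∈ A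

/-- The injective ring homomorphism `D → A` induced by `φ`. -/
noncomputable def extHom (D : Subring F) (φ : F →+* L) (A : Subring L)
    (h : ExtMem D φ A) : ↥D →+* ↥A :=
  (φ.comp D.subtype).codRestrict A.toSubsemiring (fun d => h d)

/-- The extension `A ⊇ D` is polynomially regular: `Int(D,A) = A·Int(D)`. -/
def PolyReg (D : Subring F) (φ : F →+* L) (A : Subring L) : Prop :=
  IntOn (φ '' ↑D) ↑A = ↑(Submodule.span ↥A (Polynomial.map φ '' IntR (↑D : Set F)))

/-- The extension `A ⊇ D` is weakly polynomially complete: `Int(D) ⊆ Int(A)`. -/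
def WPolyComplete (D : Subring F) (φ : F →+* L) (A : Subring L) : Prop :=
  Polynomial.map φ '' IntR (↑D : Set F) ⊆ IntR (↑A : Set L)

/-- The extension `A ⊇ D` is polynomially complete: `Int(D,A) = Int(A)`. -/
def PolyComplete (D : Subring F) (φ : F →+* L) (A : Subring L) : Prop :=
  IntOn (φ '' ↑D) ↑A = IntR (↑A : Set L)

/-- The extension `A ⊇ D` is flat: `A` is flat as a `D`-module. -/
def ExtFlat (D : Subring F) (φ : F →+* L) (A : Subring L) (h : ExtMem D φ A) : Prop :=
  letI : Module ↥D ↥A := Module.compHom ↥A (extHom D φ A h)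
  Module.Flat ↥D ↥A

/-- The extension `A ⊇ D` is t-linked: `I_t = D` implies `(IA)_t = A` for every
nonzero ideal `I` of `D`. -/
def TLinkedExt (D : Subring F) (φ : F →+* L) (A : Subring L) (h : ExtMem D φ A) : Prop :=
  ∀ I : Ideal ↥D, I ≠ ⊥ → dt ↑D (iset D ↑I) = (↑D : Set F) →
    dt ↑A (iset A ↑(Ideal.map (extHom D φ A h) I)) = (↑A : Set L)

/-- `D` is absolutely polynomially regular: every extension of `D` is polynomially
regular. -/
def AbsPolyReg (D : Subring F) : Prop :=
  ∀ (L : Type) [Field L], ∀ (φ : F →+* L) (A : Subring L),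
    ExtMem D φ A → IsQuotField A → PolyReg D φ A

/-- `D` is polynomially F-regular: every flat extension of `D` is polynomially
regular. -/
def PFReg (D : Subring F) : Prop :=
  ∀ (L : Type) [Field L], ∀ (φ : F →+* L) (A : Subring L) (h : ExtMem D φ A),
    IsQuotField A → ExtFlat D φ A h → PolyReg D φ A

/-- `D` is polynomially t-regular: every t-linked extension of `D` is polynomially
regular. -/
def PTReg (D : Subring F) : Prop :=
  ∀ (L : Type) [Field L], ∀ (φ : F →+* L) (A : Subring L) (h : ExtMem D φ A),
    IsQuotField A → TLinkedExt D φ A h → PolyReg D φ A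

/-- `D` is polynomially L-regular: `Int(S⁻¹D) = S⁻¹Int(D)` for every multiplicative
subset `S` of `D` with `0 ∉ S`. -/
def PLReg (D : Subring F) : Prop :=
  ∀ S : Submonoid ↥D, (0 : ↥D) ∉ S →
    IntR (mlocSet D ↑S) = mlocPoly D ↑S (IntR (↑D : Set F))

end Extensions

/-- The extension of an ideal `I` of `R` to an overring `S` of `R` inside a common
field: the ideal `IS` of `S` generated by `I`. -/
def extIdeal (R S : Subring F) (I : Ideal ↥R) : Ideal ↥S :=
  Ideal.span {y : ↥S | (y : F) ∈ iset R ↑I}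

/-- Within a common field: `S` is a t-linked extension of `R`. -/
def TLinkedSub (R S : Subring F) : Prop :=
  R ≤ S ∧ ∀ I : Ideal ↥R, I ≠ ⊥ → dt ↑R (iset R ↑I) = (↑R : Set F) →
    dt ↑S (iset S ↑(extIdeal R S I)) = (↑S : Set F)

/-- Localization of a subset `R` of the ambient field at `D ∖ q`. -/
def locOfSet (D : Subring F) (R : Set F) (q : Ideal ↥D) : Set F :=
  {x | ∃ y ∈ R, ∃ s : ↥D, s ∉ q ∧ (s : F) * x = y}

end IVP

open IVP Polynomial

/-- The localization `S⁻¹D` of `D` at a submonoid `S`, as a subring of `F`. -/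
def mlocSubring {F : Type} [Field F] (D : Subring F) (S : Submonoid ↥D) : Subring F where
  carrier := mlocSet D ↑S
  one_mem' := ⟨1, 1, S.one_mem, by simp⟩
  zero_mem' := ⟨0, 1, S.one_mem, by simp⟩
  mul_mem' := by
    rintro x y ⟨a, s, hs, hx⟩ ⟨b, t, ht, hy⟩
    refine ⟨a * b, s * t, S.mul_mem hs ht, ?_⟩
    push_cast
    rw [mul_mul_mul_comm, hx, hy]
  add_mem' := by
    rintro x y ⟨a, s, hs, hx⟩ ⟨b, t, ht, hy⟩
    refine ⟨t * a + s * b, s * t, S.mul_mem hs ht, ?_⟩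
    push_cast
    linear_combination (t : F) * hx + (s : F) * hy
  neg_mem' := by
    rintro x ⟨a, s, hs, hx⟩
    exact ⟨-a, s, hs, by push_cast; rw [mul_neg, hx]⟩

section

variable {F : Type} [Field F] {D : Subring F}

theorem coe_mem_mlocSubring (S : Submonoid ↥D) (a : ↥D) : (a : F) ∈ mlocSubring D S :=
  ⟨a, 1, S.one_mem, by simp⟩

theorem mem_mlocSubring_of_mul_mem {S : Submonoid ↥D} {s : ↥D} (hs : s ∈ S) {x : F}
    (h : (s : F) * x ∈ mlocSubring D S) : x ∈ mlocSubring D S := by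
  obtain ⟨a, t, ht, hx⟩ := h
  exact ⟨a, t * s, S.mul_mem ht hs, by push_cast; rw [mul_assoc, hx]⟩

theorem inv_mem_mlocSubring {S : Submonoid ↥D} {s : ↥D} (hs : s ∈ S) :
    (s : F)⁻¹ ∈ mlocSubring D S := by
  rcases eq_or_ne (s : F) 0 with h | h
  · rw [h, inv_zero]
    exact zero_mem _
  · exact ⟨1, s, hs, by simp [h]⟩

theorem mlocSubring_mono {S T : Submonoid ↥D} (h : S ≤ T) : mlocSubring D S ≤ mlocSubring D T :=
  fun _ ⟨a, s, hs, hx⟩ => ⟨a, s, h hs, hx⟩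

/-- A polynomial of `F[X]` whose coefficients lie in `T⁻¹D` has a common denominator in `T`. -/
theorem exists_mul_coeff_mem {T : Submonoid ↥D} {f : F[X]}
    (hf : ∀ n, f.coeff n ∈ mlocSubring D T) : ∃ t ∈ T, ∀ n, (t : F) * f.coeff n ∈ D := by
  choose a t ht hat using hf
  refine ⟨∏ n ∈ f.support, t n, T.prod_mem fun n _ => ht n, fun n => ?_⟩
  by_cases hn : n ∈ f.support
  · obtain ⟨c, hc⟩ := Finset.dvd_prod_of_mem t hn
    rw [hc]
    push_cast
    rw [mul_right_comm, hat]
    exact D.mul_mem (a n).2 c.2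
  · rw [notMem_support_iff.mp hn, mul_zero]
    exact D.zero_mem

theorem eval_mem_of_coeff_mem {R : Subring F} {f : F[X]} (hf : ∀ n, f.coeff n ∈ R) {x : F}
    (hx : x ∈ R) : f.eval x ∈ R := by
  rw [eval_eq_sum_range]
  exact R.sum_mem fun n _ => R.mul_mem (hf n) (R.pow_mem hx n)

/-- A polynomial taking values in `R` on a sequence whose differences are units of `R` has
coefficients in `R`. -/
theorem coeff_mem_of_eval_mem {R : Subring F} {f : F[X]} {v : ℕ → F} (hv : Function.Injective v)
    (hvR : ∀ i, v i ∈ R) (hinv : ∀ i j, i ≠ j → (v i - v j)⁻¹ ∈ R) (hf : ∀ i, f.eval (v i) ∈ R)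
    (n : ℕ) : f.coeff n ∈ R := by
  have hC : ∀ x ∈ R, C x ∈ (mapRingHom R.subtype).range := fun x hx =>
    ⟨C ⟨x, hx⟩, by simp⟩
  have hX : (X : F[X]) ∈ (mapRingHom R.subtype).range := ⟨X, by simp⟩
  have hmem : f ∈ (mapRingHom R.subtype).range := by
    have hdeg : f.degree < (Finset.range (f.natDegree + 1)).card := by
      rw [Finset.card_range]
      exact degree_le_natDegree.trans_lt (by exact_mod_cast Nat.lt_succ_self _)
    rw [Lagrange.eq_interpolate hv.injOn hdeg, Lagrange.interpolate_apply]
    refine Subring.sum_mem _ fun i _ => Subring.mul_mem _ (hC _ (hf i)) ?_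
    refine Subring.prod_mem _ fun j hj => ?_
    exact Subring.mul_mem _ (hC _ (hinv i j (Finset.ne_of_mem_erase hj).symm))
      (Subring.sub_mem _ hX (hC _ (hvR j)))
  obtain ⟨g, rfl⟩ := hmem
  simp

/-- If `p` is a prime meeting `S`, the powers of an element of `S ∩ p` have differences
that are units in `S⁻¹D_p`. -/
theorem coeff_mem_mlocSubring_sup {S : Submonoid ↥D} (hS : (0 : ↥D) ∉ S) {p : Ideal ↥D}
    [p.IsPrime] {s : ↥D} (hs : s ∈ S) (hsp : s ∈ p) {f : F[X]}
    (hf : ∀ x ∈ D, f.eval x ∈ mlocSubring D S) (n : ℕ) :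
    f.coeff n ∈ mlocSubring D (S ⊔ p.primeCompl) := by
  have hdiff : ∀ i j, i < j → s ^ j - s ^ i ∈ S ⊔ p.primeCompl ∧ s ^ j - s ^ i ≠ 0 := by
    intro i j hij
    obtain ⟨k, rfl⟩ := Nat.exists_eq_add_of_lt hij
    have hk : s ^ (k + 1) - 1 ∉ p := fun h =>
      (Ideal.ne_top_iff_one p).mp Ideal.IsPrime.ne_top' <| by
        simpa using p.sub_mem (p.pow_mem_of_mem hsp (k + 1) k.succ_pos) h
    have heq : s ^ (i + k + 1) - s ^ i = s ^ i * (s ^ (k + 1) - 1) := by ring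
    rw [heq]
    refine ⟨Submonoid.mul_mem_sup (S.pow_mem hs i) hk, mul_ne_zero ?_ ?_⟩
    · exact fun h => hS (h ▸ S.pow_mem hs i)
    · exact fun h => hk (h ▸ p.zero_mem)
  refine coeff_mem_of_eval_mem (v := fun i => ((s ^ i : ↥D) : F)) ?_
    (fun i => coe_mem_mlocSubring _ _) ?_
    (fun i => mlocSubring_mono le_sup_left (hf _ (s ^ i).2)) n
  · intro i j h
    have h' : s ^ i = s ^ j := Subtype.ext h
    rcases lt_trichotomy i j with hij | hij | hij
    · exact absurd (sub_eq_zero.mpr h'.symm) (hdiff i j hij).2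
    · exact hij
    · exact absurd (sub_eq_zero.mpr h') (hdiff j i hij).2
  · intro i j hij
    rcases hij.lt_or_gt with hij | hij
    · rw [← neg_sub, inv_neg]
      exact neg_mem (by exact_mod_cast inv_mem_mlocSubring (hdiff i j hij).1)
    · exact_mod_cast inv_mem_mlocSubring (hdiff j i hij).1

/-- `Int(D) ⊆ Int(S⁻¹D)`. -/
theorem eval_mem_mlocSubring (S : Submonoid ↥D) {g : F[X]} (hg : ∀ x ∈ D, g.eval x ∈ D) {x : F}
    (hx : x ∈ mlocSubring D S) : g.eval x ∈ mlocSubring D S := by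
  obtain ⟨a, s, hs, hax⟩ := hx
  suffices h : ∀ (n : ℕ) (g : F[X]), (∀ k, n ≤ k → g.coeff k = 0) → (∀ x ∈ D, g.eval x ∈ D) →
      g.eval x ∈ mlocSubring D S from
    h (g.natDegree + 1) g (fun k hk => coeff_eq_zero_of_natDegree_lt hk) hg
  intro n
  induction n with
  | zero =>
    intro g h0 _
    rw [show g = 0 from ext fun k => by simp [h0 k], eval_zero]
    exact zero_mem _
  | succ n ih =>
    intro g h0 hg
    have hh : (C ((s : F) ^ n) * g - g.comp (C (s : F) * X)).eval x ∈ mlocSubring D S := by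
      refine ih _ (fun k hk => ?_) fun y hy => ?_
      · rw [coeff_sub, coeff_C_mul, comp_C_mul_X_coeff]
        rcases hk.eq_or_lt with rfl | hk
        · ring
        · rw [h0 k hk]
          ring
      · simp only [eval_sub, eval_mul, eval_C, eval_comp, eval_X]
        exact D.sub_mem (D.mul_mem (D.pow_mem s.2 n) (hg y hy)) (hg _ (D.mul_mem s.2 hy))
    simp only [eval_sub, eval_mul, eval_C, eval_comp, eval_X, hax] at hh
    refine mem_mlocSubring_of_mul_mem (S.pow_mem hs n) ?_
    have := add_mem hh (coe_mem_mlocSubring S ⟨_, hg a a.2⟩)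
    simpa using this

/-- If `f` maps `D` into `S⁻¹D`, then locally at a prime some multiple of `f` by an element of
`S` is integer-valued. -/
theorem exists_mul_eval_mem_primeCompl {S : Submonoid ↥D} (hS : (0 : ↥D) ∉ S) (p : Ideal ↥D)
    [p.IsPrime] {f : F[X]} (hf : ∀ x ∈ D, f.eval x ∈ mlocSubring D S) :
    ∃ s ∈ S, ∀ x ∈ D, (s : F) * f.eval x ∈ mlocSubring D p.primeCompl := by
  by_cases h : ∃ s ∈ S, s ∈ p
  · obtain ⟨s, hs, hsp⟩ := h
    obtain ⟨t, ht, htf⟩ := exists_mul_coeff_mem (coeff_mem_mlocSubring_sup hS hs hsp hf)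
    obtain ⟨r, hr, u, hu, rfl⟩ := Submonoid.mem_sup.mp ht
    refine ⟨r, hr, fun x hx => ?_⟩
    have hD : (C ((r * u : ↥D) : F) * f).eval x ∈ D :=
      eval_mem_of_coeff_mem (fun n => by rw [coeff_C_mul]; exact htf n) hx
    refine ⟨⟨_, hD⟩, u, hu, ?_⟩
    simp only [eval_mul, eval_C]
    push_cast
    ring
  · push Not at h
    refine ⟨1, S.one_mem, fun x hx => ?_⟩
    simpa using mlocSubring_mono (T := p.primeCompl) h (hf x hx)

end

/-- If `D = ⋂_{p ∈ 𝒮} D_p` is a locally finite intersection of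
localizations at primes, then `Int(S⁻¹D) = S⁻¹Int(D)` for every multiplicative subset
`S` of `D` with `0 ∉ S`. -/
theorem stmt_0 (F : Type) [Field F] (D : Subring F)
    (hqf : IsQuotField D) (hne : (↑D : Set F) ≠ Set.univ)
    (𝒮 : Set (Ideal ↥D)) (hprime : ∀ p ∈ 𝒮, p.IsPrime)
    (hint : (↑D : Set F) = ⋂ p ∈ 𝒮, plocSet D p)
    (hfin : ∀ x : ↥D, x ≠ 0 →
      {p ∈ 𝒮 | ¬ ∃ y ∈ plocSet D p, (x : F) * y = 1}.Finite) :
    ∀ S : Submonoid ↥D, (0 : ↥D) ∉ S →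
      IntR (mlocSet D ↑S) = mlocPoly D ↑S (IntR (↑D : Set F)) := by
  intro S hS
  ext f
  refine ⟨fun hf => ?_, ?_⟩
  · have hfD : ∀ x ∈ D, f.eval x ∈ mlocSubring D S := fun x hx =>
      hf x (coe_mem_mlocSubring S ⟨x, hx⟩)
    have hloc : ∀ p ∈ 𝒮, ∃ s ∈ S, ∀ x ∈ D, (s : F) * f.eval x ∈ plocSet D p := fun p hp =>
      have := hprime p hp
      exists_mul_eval_mem_primeCompl hS p hfD
    choose! t ht htf using hloc
    obtain ⟨d, hd, hdf⟩ := exists_mul_coeff_mem (T := nonZeroDivisors ↥D) (f := f) fun n => by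
      obtain ⟨a, b, hb, hab⟩ := hqf (f.coeff n)
      exact ⟨a, b, mem_nonZeroDivisors_of_ne_zero hb, hab⟩
    have hdfin := hfin d (nonZeroDivisors.ne_zero hd)
    have hsS : ∏ p ∈ hdfin.toFinset, t p ∈ S :=
      S.prod_mem fun p hp => ht p (hdfin.mem_toFinset.mp hp).1
    refine ⟨_, fun x hx => ?_, _, hsS, rfl⟩
    rw [hint, Set.mem_iInter₂]
    intro p hp
    have := hprime p hp
    change _ ∈ mlocSubring D p.primeCompl
    rw [eval_mul, eval_C]
    by_cases hpd : ∃ y ∈ plocSet D p, (d : F) * y = 1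
    · obtain ⟨y, hy, hdy⟩ := hpd
      have hDx : (C (d : F) * f).eval x ∈ D :=
        eval_mem_of_coeff_mem (fun n => by rw [coeff_C_mul]; exact hdf n) hx
      rw [eval_mul, eval_C] at hDx
      have hfx : f.eval x = y * (d * f.eval x) := by linear_combination -f.eval x * hdy
      rw [hfx]
      exact mul_mem (coe_mem_mlocSubring _ _) (mul_mem hy (coe_mem_mlocSubring _ ⟨_, hDx⟩))
    · obtain ⟨c, hc⟩ := Finset.dvd_prod_of_mem t (hdfin.mem_toFinset.mpr ⟨hp, hpd⟩)
      rw [hc]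
      push_cast
      rw [mul_right_comm]
      exact mul_mem (htf p hp x hx) (coe_mem_mlocSubring _ c)
  · rintro ⟨g, hg, s, hs, rfl⟩ x hx
    refine mem_mlocSubring_of_mul_mem hs ?_
    simpa using eval_mem_mlocSubring S hg hx
end

section
/- Let D be an integral domain with quotient field K ≠ D of finite t-character, i.e., every nonzero element of D lies in only finitely many t-maximal ideals of D. Then Int(D_p) = Int(D)_p for every prime ideal p of D; consequently Int(S⁻¹D) = S⁻¹Int(D) for every multiplicative subset S of D with 0 ∉ S. -/
open IVP Polynomial

namespace IVP

open Polynomial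

variable {F : Type} [Field F]

/-- The localization of `D` at a submonoid `S`, as a subring of `F`. -/
def mloc (D : Subring F) (S : Submonoid ↥D) : Subring F where
  carrier := mlocSet D ↑S
  one_mem' := ⟨1, 1, S.one_mem, by simp⟩
  zero_mem' := ⟨0, 1, S.one_mem, by simp⟩
  mul_mem' := by
    rintro x y ⟨a, s, hs, hx⟩ ⟨b, t, ht, hy⟩
    exact ⟨a * b, s * t, S.mul_mem hs ht, by push_cast; rw [mul_mul_mul_comm, hx, hy]⟩
  add_mem' := by
    rintro x y ⟨a, s, hs, hx⟩ ⟨b, t, ht, hy⟩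
    refine ⟨t * a + s * b, s * t, S.mul_mem hs ht, ?_⟩
    push_cast
    rw [← hx, ← hy]
    ring
  neg_mem' := by
    rintro x ⟨a, s, hs, hx⟩
    exact ⟨-a, s, hs, by push_cast; rw [mul_neg, hx]⟩

theorem mem_mloc {D : Subring F} {S : Submonoid ↥D} {x : F} :
    x ∈ mloc D S ↔ ∃ s ∈ S, (s : F) * x ∈ D :=
  ⟨fun ⟨a, s, hs, h⟩ => ⟨s, hs, h ▸ a.2⟩, fun ⟨s, hs, h⟩ => ⟨⟨_, h⟩, s, hs, rfl⟩⟩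

theorem le_mloc (D : Subring F) (S : Submonoid ↥D) : D ≤ mloc D S :=
  fun x hx => mem_mloc.2 ⟨1, S.one_mem, by simpa using hx⟩

theorem mloc_mono {D : Subring F} {S T : Submonoid ↥D} (h : S ≤ T) : mloc D S ≤ mloc D T := by
  intro x hx
  obtain ⟨s, hs, hsx⟩ := mem_mloc.1 hx
  exact mem_mloc.2 ⟨s, h hs, hsx⟩

theorem mem_mloc_of_mul_mem {D : Subring F} {S : Submonoid ↥D} {s : ↥D} (hs : s ∈ S) {x : F}
    (h : (s : F) * x ∈ mloc D S) : x ∈ mloc D S := by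
  obtain ⟨t, ht, htx⟩ := mem_mloc.1 h
  exact mem_mloc.2 ⟨t * s, S.mul_mem ht hs, by push_cast; rwa [mul_assoc]⟩

theorem inv_mem_mloc {D : Subring F} {S : Submonoid ↥D} {s : ↥D} (hs : s ∈ S) :
    (s : F)⁻¹ ∈ mloc D S := by
  refine mem_mloc.2 ⟨s, hs, ?_⟩
  by_cases h : (s : F) = 0
  · simp [h, D.zero_mem]
  · rw [mul_inv_cancel₀ h]; exact D.one_mem

/-- A finite family of elements of a localization has a common denominator. -/
theorem exists_common_denom {D : Subring F} {S : Submonoid ↥D} {ι : Type*} (s : Finset ι)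
    (x : ι → F) (h : ∀ i ∈ s, x i ∈ mloc D S) : ∃ t ∈ S, ∀ i ∈ s, (t : F) * x i ∈ D := by
  classical
  induction s using Finset.induction_on with
  | empty => exact ⟨1, S.one_mem, by simp⟩
  | insert a s ha ih =>
    obtain ⟨t, ht, hts⟩ := ih fun i hi => h i (Finset.mem_insert_of_mem hi)
    obtain ⟨u, hu, hua⟩ := mem_mloc.1 (h a (Finset.mem_insert_self a s))
    refine ⟨t * u, S.mul_mem ht hu, fun i hi => ?_⟩
    rcases Finset.mem_insert.1 hi with rfl | hi
    · push_cast; rw [mul_assoc]; exact D.mul_mem t.2 hua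
    · push_cast; rw [mul_comm (t : F), mul_assoc]; exact D.mul_mem u.2 (hts i hi)

theorem exists_common_denom_coeff {D : Subring F} {S : Submonoid ↥D} {f : F[X]}
    (h : ∀ n, f.coeff n ∈ mloc D S) : ∃ t ∈ S, ∀ n, (t : F) * f.coeff n ∈ D := by
  obtain ⟨t, ht, H⟩ := exists_common_denom f.support f.coeff fun n _ => h n
  refine ⟨t, ht, fun n => ?_⟩
  by_cases hn : n ∈ f.support
  · exact H n hn
  · rw [notMem_support_iff.1 hn, mul_zero]; exact D.zero_mem

theorem eval_mem_of_coeff_mem {R : Subring F} {f : F[X]} (h : ∀ n, f.coeff n ∈ R) {x : F}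
    (hx : x ∈ R) : f.eval x ∈ R := by
  rw [eval_eq_sum_range]
  exact R.sum_mem fun n _ => R.mul_mem (h n) (R.pow_mem hx n)

/-- A polynomial that maps `D` into `S⁻¹D` maps `S⁻¹D` into itself. -/
theorem mem_intR_mloc {D : Subring F} {S : Submonoid ↥D} (n : ℕ) :
    ∀ f : F[X], f.natDegree < n → (∀ x ∈ D, f.eval x ∈ mloc D S) →
      ∀ x ∈ mloc D S, f.eval x ∈ mloc D S := by
  induction n with
  | zero => intro f hf; omega
  | succ n ih =>
    intro f hf hfD x hx
    obtain ⟨s, hs, hsx⟩ := mem_mloc.1 hx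
    rcases Nat.eq_zero_or_pos f.natDegree with h0 | hpos
    · have h := hfD 0 D.zero_mem
      rw [eq_C_of_natDegree_eq_zero h0, eval_C] at h ⊢
      exact h
    · set g : F[X] := f.comp (C (s : F) * X) - C ((s : F) ^ f.natDegree) * f with hg
      have hgdeg : g.natDegree < n := by
        have : g.natDegree < f.natDegree := by
          by_cases hg0 : g = 0
          · rwa [hg0, natDegree_zero]
          rw [natDegree_lt_iff_degree_lt hg0, degree_lt_iff_coeff_zero]
          intro k hk
          rw [hg, coeff_sub, coeff_C_mul, comp_C_mul_X_coeff]
          rcases hk.eq_or_lt with rfl | hk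
          · ring
          · rw [coeff_eq_zero_of_natDegree_lt hk]; ring
        omega
      have hge (y : F) : g.eval y = f.eval (s * y) - (s : F) ^ f.natDegree * f.eval y := by
        simp [hg]
      have hgx := ih g hgdeg (fun y hy => by
        rw [hge]
        exact (mloc D S).sub_mem (hfD _ (D.mul_mem s.2 hy))
          ((mloc D S).mul_mem ((mloc D S).pow_mem (le_mloc D S s.2) _) (hfD y hy))) x hx
      rw [hge] at hgx
      have hmul := (mloc D S).sub_mem (hfD _ hsx) hgx
      rw [sub_sub_cancel] at hmul
      exact mem_mloc_of_mul_mem (S.pow_mem hs f.natDegree) (by push_cast; exact hmul)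

/-- If `D/q` is infinite, then `Int(D, D_q) ⊆ D_q[X]`. -/
theorem coeff_mem_of_infinite_quotient {D : Subring F} (q : Ideal ↥D) [q.IsPrime]
    [Infinite (↥D ⧸ q)] {f : F[X]} (hf : ∀ x ∈ D, f.eval x ∈ mloc D q.primeCompl) (n : ℕ) :
    f.coeff n ∈ mloc D q.primeCompl := by
  classical
  set R := mloc D q.primeCompl
  let e := Infinite.natEmbedding (↥D ⧸ q)
  let a : ℕ → ↥D := fun i => (e i).out
  have ha (i j : ℕ) (hij : i ≠ j) : a i - a j ∈ q.primeCompl := by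
    intro h
    have h' := Ideal.Quotient.eq.2 h
    simp only [a, Ideal.Quotient.mk_out] at h'
    exact hij (e.injective h')
  have hinj : Set.InjOn (fun i => (a i : F)) (Finset.range (f.natDegree + 1) : Set ℕ) := by
    intro i _ j _ hij
    by_contra hne
    refine ha i j hne ?_
    rw [Subtype.ext hij, sub_self]
    exact q.zero_mem
  have hdeg : f.degree < (Finset.range (f.natDegree + 1)).card := by
    rw [Finset.card_range]
    exact degree_le_natDegree.trans_lt (by exact_mod_cast Nat.lt_succ_self _)
  have hlift : f ∈ lifts R.subtype := by
    have hC (c : F) (hc : c ∈ R) : C c ∈ lifts R.subtype :=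
      C_mem_lifts R.subtype ⟨c, hc⟩
    rw [Lagrange.eq_interpolate hinj hdeg, Lagrange.interpolate_apply]
    refine sum_mem fun i _ => mul_mem (hC _ (hf _ (a i).2)) ?_
    rw [Lagrange.basis]
    refine prod_mem fun j hj => ?_
    rw [Lagrange.basisDivisor, sub_eq_add_neg X, ← C_neg]
    refine mul_mem (hC _ ?_) (add_mem (X_mem_lifts _) (hC _ (R.neg_mem (le_mloc _ _ (a j).2))))
    have := inv_mem_mloc (ha i j (Finset.ne_of_mem_erase hj).symm)
    push_cast at this
    exact this
  obtain ⟨c, hc⟩ := (lifts_iff_coeff_lifts f).1 hlift n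
  rw [← hc]
  exact c.2

theorem coe_mem_iset {D : Subring F} {I : Ideal ↥D} {x : ↥D} : (x : F) ∈ iset D ↑I ↔ x ∈ I :=
  ⟨fun ⟨_, hy, h⟩ => Subtype.ext h ▸ hy, fun h => ⟨x, h, rfl⟩⟩

/-- An ideal is a t-ideal iff it is nonzero and contains `T_v` for each of its finite subsets `T`
having a nonzero element. -/
theorem isTIdeal_iff {D : Subring F} {I : Ideal ↥D} :
    IsTIdeal ↑D (iset D ↑I) ↔ (∃ y ∈ I, y ≠ 0) ∧
      ∀ T : Finset F, ↑T ⊆ iset D ↑I → (∃ y ∈ T, y ≠ 0) → dv ↑D ↑T ⊆ iset D ↑I := by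
  classical
  constructor
  · intro h
    refine ⟨?_, fun T hT hy x hx => h ▸ ⟨T, hT, hy, hx⟩⟩
    have h0 : (0 : F) ∈ dt ↑D (iset D ↑I) := h.symm ▸ ⟨0, I.zero_mem, rfl⟩
    obtain ⟨T, hT, ⟨y, hy, hy0⟩, -⟩ := h0
    obtain ⟨z, hz, rfl⟩ := hT hy
    exact ⟨z, hz, fun h => hy0 (by rw [h]; rfl)⟩
  · rintro ⟨⟨y, hy, hy0⟩, h⟩
    refine Set.Subset.antisymm (fun x ⟨T, hT, hT0, hx⟩ => h T hT hT0 hx) fun x hx => ?_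
    refine ⟨{x, (y : F)}, ?_, ⟨y, by simp, fun h => hy0 (Subtype.ext h)⟩, fun z hz => ?_⟩
    · intro z hz
      rcases (by simpa using hz : z = x ∨ z = y) with rfl | rfl
      · exact hx
      · exact ⟨y, hy, rfl⟩
    · rw [mul_comm]; exact hz x (by simp)

/-- Multiplication by `a` maps `T_v` into `(aT)_v`. -/
theorem mul_mem_dv_image {D : Set F} {T : Set F} {a x : F} (hx : x ∈ dv D T) :
    a * x ∈ dv D ((a * ·) '' T) := by
  intro z hz
  have h : z * a ∈ dinv D T := fun y hy => by
    rw [mul_assoc]; exact hz _ ⟨y, hy, rfl⟩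
  have := hx _ h
  rwa [show a * x * z = x * (z * a) by ring]

theorem IsTMax.isPrime {D : Subring F} {m : Ideal ↥D} (hm : IsTMax D m) : m.IsPrime := by
  classical
  obtain ⟨hne, ht, hmax⟩ := hm
  obtain ⟨⟨y, hy, hy0⟩, hT⟩ := isTIdeal_iff.1 ht
  refine ⟨hne, fun {a b} hab => or_iff_not_imp_left.2 fun ha => ?_⟩
  have ha0 : (a : F) ≠ 0 := fun h => ha (by
    rw [show a = 0 from Subtype.ext h]; exact m.zero_mem)
  let q : Ideal ↥D := Submodule.comap (LinearMap.mulLeft ↥D a) m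
  have hmq : m ≤ q := fun x hx => m.mul_mem_left a hx
  have hqT : IsTIdeal ↑D (iset D ↑q) := by
    refine isTIdeal_iff.2 ⟨⟨y, hmq hy, hy0⟩, fun T hTq ⟨z, hz, hz0⟩ x hx => ?_⟩
    have hxD : x ∈ D := by
      have := hx 1 fun w hw => by
        obtain ⟨w', -, rfl⟩ := hTq hw
        rw [one_mul]; exact w'.2
      rwa [mul_one] at this
    have hax : (a : F) * x ∈ iset D ↑m := by
      refine hT (T.image ((a : F) * ·)) ?_ ⟨a * z, Finset.mem_image_of_mem _ hz,
        mul_ne_zero ha0 hz0⟩ (by rw [Finset.coe_image]; exact mul_mem_dv_image hx)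
      rw [Finset.coe_image]
      rintro _ ⟨w, hw, rfl⟩
      obtain ⟨w', hw', rfl⟩ := hTq hw
      exact ⟨a * w', hw', rfl⟩
    exact ⟨⟨x, hxD⟩, (coe_mem_iset (x := a * ⟨x, hxD⟩)).1 hax, rfl⟩
  have hq : q ≠ ⊤ := fun h => ha (by
    have : (1 : ↥D) ∈ q := h ▸ Submodule.mem_top
    simpa [q] using this)
  rw [hmax q hq hqT hmq]
  exact hab

/-- Every proper t-ideal is contained in a t-maximal ideal. -/
theorem exists_le_isTMax {D : Subring F} {I : Ideal ↥D} (hI : I ≠ ⊤)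
    (ht : IsTIdeal ↑D (iset D ↑I)) : ∃ m, IsTMax D m ∧ I ≤ m := by
  classical
  obtain ⟨m, hIm, hm⟩ := zorn_le_nonempty₀ {J : Ideal ↥D | J ≠ ⊤ ∧ IsTIdeal ↑D (iset D ↑J)}
    (fun c hc hchain J hJ => by
      have hmem (x : ↥D) : x ∈ sSup c ↔ ∃ K ∈ c, x ∈ K :=
        Submodule.mem_sSup_of_directed ⟨J, hJ⟩ hchain.directedOn
      refine ⟨sSup c, ⟨fun h => ?_, isTIdeal_iff.2 ⟨?_, fun T hT hT0 => ?_⟩⟩,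
        fun K hK => le_sSup hK⟩
      · obtain ⟨K, hK, h1⟩ := (hmem 1).1 (h ▸ Submodule.mem_top)
        exact (hc hK).1 ((Ideal.eq_top_iff_one K).2 h1)
      · obtain ⟨y, hy, hy0⟩ := (isTIdeal_iff.1 (hc hJ).2).1
        exact ⟨y, (hmem y).2 ⟨J, hJ, hy⟩, hy0⟩
      · have key : ∀ T : Finset F, ↑T ⊆ iset D ↑(sSup c) → ∃ K ∈ c, ↑T ⊆ iset D (K : Set ↥D) := by
          intro T
          induction T using Finset.induction_on with
          | empty => exact fun _ => ⟨J, hJ, by simp⟩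
          | insert a T _ ih =>
            intro h
            rw [Finset.coe_insert, Set.insert_subset_iff] at h
            obtain ⟨K, hK, hTK⟩ := ih h.2
            obtain ⟨a', ha', rfl⟩ := h.1
            obtain ⟨L, hL, haL⟩ := (hmem a').1 ha'
            obtain ⟨M, hM, hKM, hLM⟩ := hchain.directedOn K hK L hL
            refine ⟨M, hM, ?_⟩
            rw [Finset.coe_insert, Set.insert_subset_iff]
            exact ⟨⟨a', hLM haL, rfl⟩, hTK.trans (Set.image_mono hKM)⟩
        obtain ⟨K, hK, hTK⟩ := key T hT
        exact ((isTIdeal_iff.1 (hc hK).2).2 T hTK hT0).trans (Set.image_mono (le_sSup hK)))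
    I ⟨hI, ht⟩
  exact ⟨m, ⟨hm.prop.1, hm.prop.2, fun q hq hqt hmq => le_antisymm hmq (hm.le_of_ge ⟨hq, hqt⟩ hmq)⟩,
    hIm⟩

/-- If `x ∉ D`, then the denominators of `x` all lie in some t-maximal ideal. -/
theorem exists_isTMax_of_notMem {D : Subring F} (hqf : IsQuotField D) {x : F} (hx : x ∉ D) :
    ∃ m, IsTMax D m ∧ ∀ d : ↥D, (d : F) * x ∈ D → d ∈ m := by
  let I : Ideal ↥D :=
    { carrier := {d | (d : F) * x ∈ D}
      zero_mem' := by simp [D.zero_mem]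
      add_mem' := fun {a b} ha hb => by
        simp only [Set.mem_ofPred_eq, Subring.coe_add, add_mul] at *
        exact D.add_mem ha hb
      smul_mem' := fun c a ha => by
        simp only [Set.mem_ofPred_eq, smul_eq_mul, Subring.coe_mul, mul_assoc] at *
        exact D.mul_mem c.2 ha }
  have hI : I ≠ ⊤ := fun h => hx (by
    have : ((1 : ↥D) : F) * x ∈ D := show (1 : ↥D) ∈ I from h ▸ Submodule.mem_top
    simpa using this)
  obtain ⟨a, b, hb, hab⟩ := hqf x
  have ht : IsTIdeal ↑D (iset D ↑I) := by
    refine isTIdeal_iff.2 ⟨⟨b, show (b : F) * x ∈ D from hab ▸ a.2, hb⟩, fun T hT _ z hz => ?_⟩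
    have h1 := hz 1 fun w hw => by
      obtain ⟨w', -, rfl⟩ := hT hw
      rw [one_mul]; exact w'.2
    rw [mul_one] at h1
    refine ⟨⟨z, h1⟩, hz x fun w hw => ?_, rfl⟩
    obtain ⟨w', hw', rfl⟩ := hT hw
    rw [mul_comm]; exact hw'
  obtain ⟨m, hm, hIm⟩ := exists_le_isTMax hI ht
  exact ⟨m, hm, fun d hd => hIm hd⟩

/-- If `f` maps `D` into `S⁻¹D`, then for every prime `m` some element of `S` multiplies `f` into
`Int(D, D_m)`. -/
theorem exists_mul_eval_mem_primeLoc {D : Subring F} {S : Submonoid ↥D}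
    {f : F[X]} (hf : ∀ x ∈ D, f.eval x ∈ mloc D S) (m : Ideal ↥D) [hm : m.IsPrime] :
    ∃ s ∈ S, ∀ x ∈ D, (s : F) * f.eval x ∈ mloc D m.primeCompl := by
  by_cases hS : S ≤ m.primeCompl
  · exact ⟨1, S.one_mem, fun x hx => by simpa using mloc_mono hS (hf x hx)⟩
  set R := mloc D m.primeCompl
  let I : Ideal ↥D :=
    { carrier := {d | ∀ n, (d : F) * f.coeff n ∈ R}
      zero_mem' := fun n => by simp [R.zero_mem]
      add_mem' := fun {a b} ha hb n => by
        rw [Subring.coe_add, add_mul]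
        exact R.add_mem (ha n) (hb n)
      smul_mem' := fun c a ha n => by
        rw [smul_eq_mul, Subring.coe_mul, mul_assoc]
        exact R.mul_mem (le_mloc _ _ c.2) (ha n) }
  by_cases hdisj : Disjoint (I : Set ↥D) ↑(S ⊔ m.primeCompl)
  · obtain ⟨q, hq, hIq, hqd⟩ := Ideal.exists_le_prime_disjoint I _ hdisj
    have hSq : S ≤ q.primeCompl := fun s hs hsq =>
      Set.disjoint_left.1 hqd hsq (Submonoid.mem_sup_left hs)
    have hqm : q ≤ m := fun x hx => by
      by_contra hxm
      exact Set.disjoint_left.1 hqd hx (Submonoid.mem_sup_right hxm)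
    have hinf : Infinite (↥D ⧸ q) := by
      by_contra hfin
      rw [not_infinite_iff_finite] at hfin
      have hmax : q.IsMaximal :=
        Ideal.Quotient.maximal_of_isField q (Finite.isField_of_domain (↥D ⧸ q))
      exact hS (hmax.eq_of_le hm.ne_top hqm ▸ hSq)
    obtain ⟨t, ht, htf⟩ := exists_common_denom_coeff
      (coeff_mem_of_infinite_quotient q fun x hx => mloc_mono hSq (hf x hx))
    exact absurd (hIq (show t ∈ I from fun n => le_mloc _ _ (htf n))) ht
  · obtain ⟨d, hdI, hd⟩ := Set.not_disjoint_iff.1 hdisj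
    obtain ⟨s, hs, u, hu, rfl⟩ := Submonoid.mem_sup.1 hd
    refine ⟨s, hs, fun x hx => ?_⟩
    rw [← eval_C_mul]
    refine eval_mem_of_coeff_mem (fun n => ?_) (le_mloc _ _ hx)
    rw [coeff_C_mul]
    refine mem_mloc_of_mul_mem hu ?_
    have := hdI n
    rwa [Subring.coe_mul, mul_comm (s : F), mul_assoc] at this

/-- If `f` maps `D` into `S⁻¹D`, then some element of `S` multiplies `f` into `Int(D)`. -/
theorem exists_mul_mem_intR {D : Subring F} (hqf : IsQuotField D)
    (hfin : ∀ x : ↥D, x ≠ 0 → {p : Ideal ↥D | IsTMax D p ∧ x ∈ p}.Finite) {S : Submonoid ↥D}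
    {f : F[X]} (hf : ∀ x ∈ D, f.eval x ∈ mloc D S) :
    ∃ s ∈ S, ∀ x ∈ D, (s : F) * f.eval x ∈ D := by
  classical
  have hcoeff (n : ℕ) : f.coeff n ∈ mloc D (nonZeroDivisors ↥D) := by
    obtain ⟨a, b, hb, hab⟩ := hqf (f.coeff n)
    exact mem_mloc.2 ⟨b, mem_nonZeroDivisors_of_ne_zero hb, hab ▸ a.2⟩
  obtain ⟨d, hd, hdf⟩ := exists_common_denom_coeff hcoeff
  have hloc (m : Ideal ↥D) : ∃ s ∈ S, ∀ hm : IsTMax D m, ∀ x ∈ D,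
      (s : F) * f.eval x ∈ mloc D (@Ideal.primeCompl _ _ m hm.isPrime) := by
    by_cases hm : IsTMax D m
    · have := hm.isPrime
      obtain ⟨s, hs, h⟩ := exists_mul_eval_mem_primeLoc hf m
      exact ⟨s, hs, fun _ => h⟩
    · exact ⟨1, S.one_mem, fun h => absurd h hm⟩
  choose s hs hsf using hloc
  set A := (hfin d (nonZeroDivisors.ne_zero hd)).toFinset
  refine ⟨∏ m ∈ A, s m, S.prod_mem fun m _ => hs m, fun x hx => ?_⟩
  by_contra hnot
  obtain ⟨m, hm, hden⟩ := exists_isTMax_of_notMem hqf hnot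
  have hdm : d ∈ m := by
    refine hden d ?_
    rw [mul_left_comm, ← eval_C_mul]
    exact D.mul_mem (Subtype.prop _)
      (eval_mem_of_coeff_mem (fun n => by rw [coeff_C_mul]; exact hdf n) hx)
  have hmA : m ∈ A := (Set.Finite.mem_toFinset _).2 ⟨hm, hdm⟩
  obtain ⟨u, hu, hus⟩ := mem_mloc.1 (hsf m hm x hx)
  refine hu (hden u ?_)
  rw [← Finset.mul_prod_erase A s hmA, Subring.coe_mul]
  have := D.mul_mem (Subtype.prop (∏ m ∈ A.erase m, s m)) hus
  convert this using 1
  ring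

/-- Over a domain of finite t-character, `Int(S⁻¹D) = S⁻¹Int(D)`. -/
theorem intR_mlocSet {D : Subring F} (hqf : IsQuotField D)
    (hfin : ∀ x : ↥D, x ≠ 0 → {p : Ideal ↥D | IsTMax D p ∧ x ∈ p}.Finite) (S : Submonoid ↥D) :
    IntR (mlocSet D ↑S) = mlocPoly D ↑S (IntR (↑D : Set F)) := by
  ext f
  constructor
  · intro hf
    obtain ⟨s, hs, h⟩ :=
      exists_mul_mem_intR hqf hfin (S := S) fun x hx => hf x (le_mloc D S hx)
    exact ⟨_, fun x hx => by rw [eval_C_mul]; exact h x hx, s, hs, rfl⟩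
  · rintro ⟨_, hg, s, hs, rfl⟩
    exact mem_intR_mloc _ f (Nat.lt_succ_self _) fun x hx =>
      mem_mloc.2 ⟨s, hs, by simpa using hg x hx⟩

end IVP

/-- If `D` has finite t-character then `Int(D_p) = Int(D)_p` for
every prime `p`, and consequently `Int(S⁻¹D) = S⁻¹Int(D)` for every multiplicative
subset `S` with `0 ∉ S`. -/
theorem stmt_1 (F : Type) [Field F] (D : Subring F)
    (hqf : IsQuotField D) (hne : (↑D : Set F) ≠ Set.univ)
    (hfin : ∀ x : ↥D, x ≠ 0 → {p : Ideal ↥D | IsTMax D p ∧ x ∈ p}.Finite) :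
    (∀ p : Ideal ↥D, p.IsPrime →
        IntR (plocSet D p) = plocPoly D p (IntR (↑D : Set F))) ∧
      ∀ S : Submonoid ↥D, (0 : ↥D) ∉ S →
        IntR (mlocSet D ↑S) = mlocPoly D ↑S (IntR (↑D : Set F)) := by
  exact ⟨fun p _ => intR_mlocSet hqf hfin p.primeCompl, fun S _ => intR_mlocSet hqf hfin S⟩
end

section
/- Let D be an integral domain with quotient field K ≠ D and let p and q be prime ideals of D. Then (Int(D_p))_q = (Int(D_q))_p as subsets of K[X], where (·)_q denotes localization at the multiplicative set D ∖ q inside K[X]. Moreover, if p ≠ q, then (Int(D_p))_q = (D_p)_q[X], where (D_p)_q is the localization of D_p at D ∖ q inside K. -/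
open IVP Polynomial

namespace IVP

variable {F : Type} [Field F]

/-- A polynomial taking values in a subring `R` on more than `deg f` points of `R` whose pairwise
differences are units of `R` has all its coefficients in `R`. -/
lemma coeff_mem_of_eval_mem (R : Subring F) (f : Polynomial F) (v : ℕ → F)
    (hv : ∀ i, v i ∈ R) (hne : ∀ i j, i ≠ j → v i ≠ v j)
    (hinv : ∀ i j, i ≠ j → (v i - v j)⁻¹ ∈ R)
    (hf : ∀ i, f.eval (v i) ∈ R) (n : ℕ) : f.coeff n ∈ R := by
  have hC : ∀ r ∈ R, (C r : Polynomial F) ∈ (mapRingHom R.subtype).range :=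
    fun r hr => ⟨C ⟨r, hr⟩, by simp⟩
  have hX : (X : Polynomial F) ∈ (mapRingHom R.subtype).range := ⟨X, by simp⟩
  have key : f ∈ (mapRingHom R.subtype).range := by
    rw [Lagrange.eq_interpolate (s := Finset.range (f.natDegree + 1)) (v := v) (f := f)
      (fun i _ j _ h => by_contra fun hij => hne i j hij h)
      (by
        rw [Finset.card_range]
        exact degree_le_natDegree.trans_lt (by exact_mod_cast Nat.lt_succ_self _)),
      Lagrange.interpolate_apply]
    refine sum_mem fun i _ => mul_mem (hC _ (hf i)) (prod_mem fun j hj => ?_)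
    exact mul_mem (hC _ (hinv i j (Finset.ne_of_mem_erase hj).symm))
      (sub_mem hX (hC _ (hv j)))
  obtain ⟨g, rfl⟩ := key
  simp

lemma le_primeLoc (D : Subring F) (p : Ideal ↥D) (hp : p.IsPrime) : D ≤ primeLoc D p hp :=
  fun x hx => ⟨⟨x, hx⟩, 1, p.ne_top_iff_one.mp hp.ne_top, by simp⟩

lemma inv_mem_primeLoc (D : Subring F) (p : Ideal ↥D) (hp : p.IsPrime) {s : ↥D} (hs : s ∉ p) :
    (s : F)⁻¹ ∈ primeLoc D p hp := by
  have h0 : (s : F) ≠ 0 := fun h => hs (by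
    rw [show s = 0 from Subtype.ext h]; exact p.zero_mem)
  exact ⟨1, s, hs, by simp [h0]⟩

/-- The localization `(D_p)_q` as a subring of `F`. -/
def doubleLoc (D : Subring F) (p q : Ideal ↥D) (hp : p.IsPrime) (hq : q.IsPrime) : Subring F :=
  mixedLoc D (primeLoc D p hp) (le_primeLoc D p hp) q hq

lemma mem_locOfSet_iff (D : Subring F) (p q : Ideal ↥D) (x : F) :
    x ∈ locOfSet D (plocSet D p) q ↔
      ∃ a s t : ↥D, s ∉ p ∧ t ∉ q ∧ (s : F) * t * x = a := by
  constructor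
  · rintro ⟨y, ⟨a, s, hs, h⟩, t, ht, rfl⟩
    exact ⟨a, s, t, hs, ht, by rw [mul_assoc, h]⟩
  · rintro ⟨a, s, t, hs, ht, h⟩
    exact ⟨t * x, ⟨a, s, hs, by rw [← mul_assoc, h]⟩, t, ht, rfl⟩

lemma locOfSet_plocSet_comm (D : Subring F) (p q : Ideal ↥D) :
    locOfSet D (plocSet D p) q = locOfSet D (plocSet D q) p := by
  ext x
  rw [mem_locOfSet_iff, mem_locOfSet_iff]
  constructor <;>
  · rintro ⟨a, s, t, hs, ht, h⟩
    exact ⟨a, t, s, ht, hs, by rw [mul_comm (t : F), h]⟩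

lemma mem_doubleLoc_iff (D : Subring F) (p q : Ideal ↥D) (hp : p.IsPrime) (hq : q.IsPrime)
    (x : F) : x ∈ doubleLoc D p q hp hq ↔ x ∈ locOfSet D (plocSet D p) q := by
  constructor
  · rintro ⟨a, s, hs, h⟩
    exact ⟨a, a.2, s, hs, h⟩
  · rintro ⟨y, hy, s, hs, h⟩
    exact ⟨⟨y, hy⟩, s, hs, h⟩

lemma primeLoc_le_doubleLoc (D : Subring F) (p q : Ideal ↥D) (hp : p.IsPrime) (hq : q.IsPrime) :
    primeLoc D p hp ≤ doubleLoc D p q hp hq :=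
  fun x hx => ⟨⟨x, hx⟩, 1, q.ne_top_iff_one.mp hq.ne_top, by simp⟩

lemma inv_mem_doubleLoc (D : Subring F) (p q : Ideal ↥D) (hp : p.IsPrime) (hq : q.IsPrime)
    {s : ↥D} (hs : s ∉ p ∨ s ∉ q) : (s : F)⁻¹ ∈ doubleLoc D p q hp hq := by
  rcases hs with hs | hs
  · exact primeLoc_le_doubleLoc D p q hp hq (inv_mem_primeLoc D p hp hs)
  · rw [mem_doubleLoc_iff, locOfSet_plocSet_comm, ← mem_doubleLoc_iff D q p hq hp]
    exact primeLoc_le_doubleLoc D q p hq hp (inv_mem_primeLoc D q hq hs)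

lemma one_sub_pow_notMem {R : Type*} [CommRing R] {p : Ideal R} (hp : p ≠ ⊤) {t : R} (ht : t ∈ p)
    {k : ℕ} (hk : k ≠ 0) : 1 - t ^ k ∉ p := fun h =>
  p.ne_top_iff_one.mp hp (by
    simpa using p.add_mem h (p.pow_mem_of_mem ht k (Nat.pos_of_ne_zero hk)))

/-- If `p ≠ q`, some `t ≠ 0` in `D` has `t` and all the `1 - t ^ k` outside `p` or outside `q`. -/
lemma exists_pow_notMem (D : Subring F) {p q : Ideal ↥D} (hp : p.IsPrime) (hq : q.IsPrime)
    (hpq : p ≠ q) :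
    ∃ t : ↥D, (t ∉ p ∨ t ∉ q) ∧ ∀ k : ℕ, k ≠ 0 → 1 - t ^ k ∉ p ∨ 1 - t ^ k ∉ q := by
  by_cases h : p ≤ q
  · obtain ⟨t, htq, htp⟩ := SetLike.not_le_iff_exists.mp fun h' => hpq (le_antisymm h h')
    exact ⟨t, .inl htp, fun k hk => .inr (one_sub_pow_notMem hq.ne_top htq hk)⟩
  · obtain ⟨t, htp, htq⟩ := SetLike.not_le_iff_exists.mp h
    exact ⟨t, .inr htq, fun k hk => .inl (one_sub_pow_notMem hp.ne_top htp hk)⟩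

lemma coeff_mem_doubleLoc (D : Subring F) {p q : Ideal ↥D} (hp : p.IsPrime) (hq : q.IsPrime)
    (hpq : p ≠ q) {g : Polynomial F} (hg : g ∈ IntR (plocSet D p)) (n : ℕ) :
    g.coeff n ∈ doubleLoc D p q hp hq := by
  obtain ⟨t, ht, htk⟩ := exists_pow_notMem D hp hq hpq
  have ne_zero : ∀ s : ↥D, (s ∉ p ∨ s ∉ q) → (s : F) ≠ 0 := by
    intro s hs h
    obtain rfl : s = 0 := Subtype.ext h
    exact hs.elim (· p.zero_mem) (· q.zero_mem)
  have hlt : ∀ i j, i < j → (t : F) ^ i - (t : F) ^ j ≠ 0 ∧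
      ((t : F) ^ i - (t : F) ^ j)⁻¹ ∈ doubleLoc D p q hp hq := by
    intro i j hij
    obtain ⟨k, rfl⟩ := Nat.exists_eq_add_of_lt hij
    have hk := htk (k + 1) k.succ_ne_zero
    have hfac : (t : F) ^ i - (t : F) ^ (i + k + 1) = (t : F) ^ i * ↑(1 - t ^ (k + 1)) := by
      push_cast
      ring
    rw [hfac, mul_inv, ← inv_pow]
    exact ⟨mul_ne_zero (pow_ne_zero _ (ne_zero t ht)) (ne_zero _ hk),
      mul_mem (pow_mem (inv_mem_doubleLoc D p q hp hq ht) _) (inv_mem_doubleLoc D p q hp hq hk)⟩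
  have hD : ∀ i, (t : F) ^ i ∈ primeLoc D p hp :=
    fun i => le_primeLoc D p hp (pow_mem t.2 i)
  refine coeff_mem_of_eval_mem _ g (fun i => (t : F) ^ i)
    (fun i => primeLoc_le_doubleLoc D p q hp hq (hD i)) (fun i j hij => ?_) (fun i j hij => ?_)
    (fun i => primeLoc_le_doubleLoc D p q hp hq (hg _ (hD i))) n
  · rcases hij.lt_or_gt with h | h
    · exact sub_ne_zero.mp (hlt i j h).1
    · exact (sub_ne_zero.mp (hlt j i h).1).symm
  · rcases hij.lt_or_gt with h | h
    · exact (hlt i j h).2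
    · rw [← neg_sub, inv_neg]
      exact neg_mem (hlt j i h).2

lemma exists_common_denominator (D A : Subring F) (hDA : D ≤ A) (q : Ideal ↥D) (hq : q.IsPrime)
    (c : ℕ → F) (T : Finset ℕ) (hc : ∀ n, c n ∈ locOfSet D ↑A q) :
    ∃ s : ↥D, s ∉ q ∧ ∀ n ∈ T, (s : F) * c n ∈ A := by
  induction T using Finset.induction_on with
  | empty => exact ⟨1, q.ne_top_iff_one.mp hq.ne_top, by simp⟩
  | insert m T _ ih =>
    obtain ⟨s, hs, h⟩ := ih
    obtain ⟨y, hy, t, ht, hty⟩ := hc m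
    refine ⟨s * t, fun hst => (hq.mem_or_mem hst).elim hs ht, fun n hn => ?_⟩
    push_cast
    rcases Finset.mem_insert.mp hn with rfl | hn
    · rw [mul_assoc, hty]
      exact mul_mem (hDA s.2) hy
    · rw [mul_comm (s : F), mul_assoc]
      exact mul_mem (hDA t.2) (h n hn)

theorem plocPoly_intR_plocSet (D : Subring F) {p q : Ideal ↥D} (hp : p.IsPrime) (hq : q.IsPrime)
    (hpq : p ≠ q) :
    plocPoly D q (IntR (plocSet D p)) = polySet (locOfSet D (plocSet D p) q) := by
  ext f
  constructor
  · rintro ⟨g, hg, s, hs, rfl⟩ n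
    rw [← mem_doubleLoc_iff D p q hp hq]
    have hs0 : (s : F) ≠ 0 := fun h => hs (by
      rw [show s = 0 from Subtype.ext h]; exact q.zero_mem)
    have h := mul_mem (inv_mem_doubleLoc D p q hp hq (.inr hs))
      (coeff_mem_doubleLoc D hp hq hpq hg n)
    rwa [coeff_C_mul, inv_mul_cancel_left₀ hs0] at h
  · intro hf
    obtain ⟨s, hs, h⟩ := exists_common_denominator D (primeLoc D p hp) (le_primeLoc D p hp) q hq
      f.coeff f.support hf
    refine ⟨C (s : F) * f, fun x hx => ?_, s, hs, rfl⟩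
    rw [eval_mul, eval_C, eval_eq_sum, Polynomial.sum, Finset.mul_sum]
    refine sum_mem (S := primeLoc D p hp) fun n hn => ?_
    rw [← mul_assoc]
    exact mul_mem (h n hn) (pow_mem (S := primeLoc D p hp) hx n)

end IVP

/-- `(Int(D_p))_q = (Int(D_q))_p` for any primes `p, q` of `D`, and
if `p ≠ q` then `(Int(D_p))_q = (D_p)_q[X]`. -/
theorem stmt_3 (F : Type) [Field F] (D : Subring F)
    (hqf : IsQuotField D) (hne : (↑D : Set F) ≠ Set.univ)
    (p q : Ideal ↥D) (hp : p.IsPrime) (hq : q.IsPrime) :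
    plocPoly D q (IntR (plocSet D p)) = plocPoly D p (IntR (plocSet D q)) ∧
      (p ≠ q →
        plocPoly D q (IntR (plocSet D p)) = polySet (locOfSet D (plocSet D p) q)) := by
  refine ⟨?_, plocPoly_intR_plocSet D hp hq⟩
  by_cases hpq : p = q
  · rw [hpq]
  · rw [plocPoly_intR_plocSet D hp hq hpq, plocPoly_intR_plocSet D hq hp (Ne.symm hpq),
      locOfSet_plocSet_comm]
end

section
/- Let D be a Prüfer v-multiplication domain (PVMD). Then D is an H domain (every v-invertible ideal of D is t-invertible) if and only if every t-maximal ideal of D is t-invertible. -/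
open IVP Polynomial

namespace IVP

variable {F : Type} [Field F] {D : Subring F}

theorem dinv_anti {A S T : Set F} (h : S ⊆ T) : dinv A T ⊆ dinv A S :=
  fun _ hx y hy => hx y (h hy)

theorem dv_mono {A S T : Set F} (h : S ⊆ T) : dv A S ⊆ dv A T :=
  dinv_anti (dinv_anti h)

theorem subset_dv (A S : Set F) : S ⊆ dv A S :=
  fun x hx y hy => mul_comm y x ▸ hy x hx

theorem dinv_subset_of_subset_dv {A S T : Set F} (h : T ⊆ dv A S) : dinv A S ⊆ dinv A T :=
  (subset_dv A (dinv A S)).trans (dinv_anti h)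

theorem dv_subset_of_subset_dv {A S T : Set F} (h : T ⊆ dv A S) : dv A T ⊆ dv A S :=
  dinv_anti (dinv_subset_of_subset_dv h)

theorem one_mem_dv {A S : Set F} : 1 ∈ dv A S ↔ dinv A S ⊆ A := by
  simp only [dv, dinv, Set.mem_ofPred_eq, one_mul, Set.subset_def]

theorem dv_subset {S : Set F} (h : S ⊆ D) : dv (D : Set F) S ⊆ D :=
  fun x hx => by simpa using hx 1 fun y hy => by simpa using h hy

theorem mul_mem_dinv {S : Set F} {d x : F} (hd : d ∈ D) (hx : x ∈ dinv (D : Set F) S) :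
    d * x ∈ dinv (D : Set F) S :=
  fun y hy => by rw [mul_assoc]; exact D.mul_mem hd (hx y hy)

theorem add_mem_dinv {S : Set F} {x y : F} (hx : x ∈ dinv (D : Set F) S)
    (hy : y ∈ dinv (D : Set F) S) : x + y ∈ dinv (D : Set F) S :=
  fun z hz => by rw [add_mul]; exact D.add_mem (hx z hz) (hy z hz)

theorem setMul_dinv_subset (S : Set F) : setMul (dinv (D : Set F) S) S ⊆ D := by
  rintro _ ⟨x, hx, y, hy, rfl⟩
  exact hx y hy

theorem iset_subset (S : Set D) : iset D S ⊆ D := by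
  rintro _ ⟨x, -, rfl⟩
  exact x.2

/-- The ideal of all elements of `D` lying in `T_v` for some finite `T ⊆ S`. -/
def tIdeal (D : Subring F) (S : Set F) : Ideal D where
  carrier := {x | ∃ T : Finset F, ↑T ⊆ S ∧ (x : F) ∈ dv D ↑T}
  zero_mem' := ⟨∅, by simp, fun y _ => by simp⟩
  add_mem' := by
    classical
    rintro x y ⟨T, hT, hx⟩ ⟨U, hU, hy⟩
    refine ⟨T ∪ U, by simp [hT, hU], ?_⟩
    exact add_mem_dinv (dv_mono (by simp) hx) (dv_mono (by simp) hy)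
  smul_mem' := by
    rintro d x ⟨T, hT, hx⟩
    exact ⟨T, hT, mul_mem_dinv d.2 hx⟩

theorem tIdeal_mono {S T : Set F} (h : S ⊆ T) : tIdeal D S ≤ tIdeal D T :=
  fun _ ⟨U, hU, hx⟩ => ⟨U, hU.trans h, hx⟩

theorem mem_tIdeal_of_mem {S : Set F} {x : D} (h : (x : F) ∈ S) : x ∈ tIdeal D S :=
  ⟨{(x : F)}, by simpa using h, subset_dv _ _ (by simp)⟩

theorem exists_finset_subset_dv {S : Set F} (T : Finset F)
    (hT : (T : Set F) ⊆ iset D (tIdeal D S)) :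
    ∃ U : Finset F, ↑U ⊆ S ∧ (T : Set F) ⊆ dv D ↑U := by
  classical
  induction T using Finset.induction_on with
  | empty => exact ⟨∅, by simp, by simp⟩
  | insert a T _ ih =>
    rw [Finset.coe_insert, Set.insert_subset_iff] at hT
    obtain ⟨U, hU, hTU⟩ := ih hT.2
    obtain ⟨x, ⟨V, hV, hx⟩, rfl⟩ := hT.1
    refine ⟨U ∪ V, by simp [hU, hV], ?_⟩
    rw [Finset.coe_insert, Set.insert_subset_iff]
    exact ⟨dv_mono (by simp) hx, hTU.trans (dv_mono (by simp))⟩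

theorem tIdeal_tIdeal (S : Set F) : tIdeal D (iset D (tIdeal D S)) = tIdeal D S := by
  refine le_antisymm ?_ fun x hx => mem_tIdeal_of_mem (Set.mem_image_of_mem _ hx)
  rintro x ⟨T, hT, hx⟩
  obtain ⟨U, hU, hTU⟩ := exists_finset_subset_dv T hT
  exact ⟨U, hU, dv_subset_of_subset_dv hTU hx⟩

theorem iset_tIdeal_of_exists_ne_zero {S : Set F} (hS : S ⊆ D) (h0 : ∃ y ∈ S, y ≠ 0) :
    iset D (tIdeal D S) = dt D S := by
  classical
  obtain ⟨y, hy, hy0⟩ := h0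
  ext x
  constructor
  · rintro ⟨x, ⟨T, hT, hx⟩, rfl⟩
    exact ⟨insert y T, by simp [Set.insert_subset_iff, hy, hT], ⟨y, by simp, hy0⟩,
      dv_mono (by simp) hx⟩
  · rintro ⟨T, hT, -, hx⟩
    exact ⟨⟨x, dv_subset (hT.trans hS) hx⟩, ⟨T, hT, hx⟩, rfl⟩

theorem exists_mem_iset_ne_zero {p : Ideal D} : (∃ y ∈ iset D p, y ≠ 0) ↔ p ≠ ⊥ := by
  simp [Submodule.ne_bot_iff, iset]

theorem IsTIdeal.ne_bot {p : Ideal D} (hp : IsTIdeal D (iset D p)) : p ≠ ⊥ := by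
  have h : (0 : F) ∈ iset D p := ⟨0, p.zero_mem, rfl⟩
  rw [← hp] at h
  obtain ⟨T, hT, ⟨y, hy, hy0⟩, -⟩ := h
  exact exists_mem_iset_ne_zero.1 ⟨y, hT hy, hy0⟩

theorem isTIdeal_iff_s4 {p : Ideal D} :
    IsTIdeal D (iset D p) ↔ p ≠ ⊥ ∧ tIdeal D (iset D p) = p := by
  have inj : Function.Injective (iset D) := Subtype.val_injective.image_injective
  constructor
  · intro h
    refine ⟨h.ne_bot, SetLike.coe_injective (inj ?_)⟩
    rw [iset_tIdeal_of_exists_ne_zero (iset_subset _) (exists_mem_iset_ne_zero.2 h.ne_bot), h]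
  · rintro ⟨h0, h⟩
    rw [IsTIdeal, ← iset_tIdeal_of_exists_ne_zero (iset_subset _) (exists_mem_iset_ne_zero.2 h0), h]

theorem iset_top : iset D ((⊤ : Ideal D) : Set D) = D := by
  simp [iset]

theorem tInv_iff {I : Ideal D} (h0 : I ≠ ⊥) :
    TInv D I ↔ tIdeal D (setMul (dinv D (iset D I)) (iset D I)) = ⊤ := by
  obtain ⟨y, hy, hy0⟩ := exists_mem_iset_ne_zero.2 h0
  have h1 : (1 : F) ∈ dinv (D : Set F) (iset D I) :=
    fun z hz => by simpa using iset_subset _ hz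
  rw [TInv, ← iset_tIdeal_of_exists_ne_zero (setMul_dinv_subset _)
    ⟨y, ⟨1, h1, y, hy, (one_mul y).symm⟩, hy0⟩, ← iset_top]
  exact (Subtype.val_injective.image_injective.eq_iff).trans SetLike.coe_injective.eq_iff

theorem vInv_iff {I : Ideal D} :
    VInv D I ↔ dinv (D : Set F) (setMul (dinv D (iset D I)) (iset D I)) ⊆ D := by
  rw [VInv, ← one_mem_dv]
  refine ⟨fun h => h.symm.subset D.one_mem, fun h => ?_⟩
  refine (dv_subset (setMul_dinv_subset _)).antisymm fun x hx => ?_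
  rw [← mul_one x]
  exact mul_mem_dinv hx h

theorem exists_isTMax_le {q : Ideal D} (h0 : q ≠ ⊥) (hq : tIdeal D (iset D q) ≠ ⊤) :
    ∃ p, IsTMax D p ∧ q ≤ p := by
  have chain : ∀ c ⊆ {p : Ideal D | tIdeal D (iset D p) ≠ ⊤}, IsChain (· ≤ ·) c →
      ∀ y ∈ c, ∃ ub ∈ {p : Ideal D | tIdeal D (iset D p) ≠ ⊤}, ∀ z ∈ c, z ≤ ub := by
    classical
    intro c hc hchain y hy
    refine ⟨sSup c, fun htop => ?_, fun z hz => le_sSup hz⟩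
    obtain ⟨T, hT, h1⟩ := (Ideal.eq_top_iff_one _).1 htop
    have key : ∃ p ∈ c, (T : Set F) ⊆ iset D p := by
      clear h1
      induction T using Finset.induction_on with
      | empty => exact ⟨y, hy, by simp⟩
      | insert a T _ ih =>
        rw [Finset.coe_insert, Set.insert_subset_iff] at hT
        obtain ⟨p, hp, hTp⟩ := ih hT.2
        obtain ⟨x, hx, rfl⟩ := hT.1
        obtain ⟨r, hr, hxr⟩ := (Submodule.mem_sSup_of_directed ⟨y, hy⟩ hchain.directedOn).1 hx
        obtain ⟨s, hs, hps, hrs⟩ := hchain.directedOn p hp r hr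
        refine ⟨s, hs, ?_⟩
        rw [Finset.coe_insert, Set.insert_subset_iff]
        exact ⟨⟨x, hrs hxr, rfl⟩, hTp.trans (Set.image_mono hps)⟩
    obtain ⟨p, hp, hTp⟩ := key
    exact hc hp ((Ideal.eq_top_iff_one _).2 ⟨T, hTp, h1⟩)
  obtain ⟨p, hqp, hp⟩ := zorn_le_nonempty₀ _ chain q hq
  have le_tIdeal (r : Ideal D) : r ≤ tIdeal D (iset D r) :=
    fun x hx => mem_tIdeal_of_mem ⟨x, hx, rfl⟩
  refine ⟨p, ⟨?_, isTIdeal_iff_s4.2 ⟨ne_bot_of_le_ne_bot h0 hqp, ?_⟩, fun r hr hrt hpr => ?_⟩, hqp⟩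
  · rintro rfl
    exact hp.prop (top_le_iff.1 (le_tIdeal ⊤))
  · refine (hp.eq_of_le ?_ (le_tIdeal p)).symm
    simpa [tIdeal_tIdeal] using hp.prop
  · refine hp.eq_of_le ?_ hpr
    simpa [(isTIdeal_iff_s4.1 hrt).2] using hr

/-- A t-invertible t-ideal is the v-closure of a finite subset, hence a v-ideal. -/
theorem IsTIdeal.dv_iset_subset {p : Ideal D} (hp : IsTIdeal D (iset D p)) (h : TInv D p) :
    dv D (iset D p) ⊆ iset D p := by
  classical
  obtain ⟨T, hT, h1⟩ := (Ideal.eq_top_iff_one _).1 ((tInv_iff hp.ne_bot).1 h)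
  have key : ∀ t ∈ T, ∃ y ∈ iset D p, ∃ x ∈ dinv D (iset D p), t = x * y := fun t ht => by
    obtain ⟨x, hx, y, hy, rfl⟩ := hT ht
    exact ⟨y, hy, x, hx, rfl⟩
  choose! f hf g hg hfg using key
  have hU : ((T.image f : Finset F) : Set F) ⊆ iset D p := by
    simpa [Set.subset_def] using hf
  have hpU : iset D p ⊆ dv D ↑(T.image f) := fun x hx z hz => by
    refine one_mem_dv.1 h1 fun t ht => ?_
    rw [hfg t ht, show x * z * (g t * f t) = (g t * x) * (z * f t) by ring]
    exact D.mul_mem (hg t ht x hx) (hz _ (by simpa using ⟨t, ht, rfl⟩))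
  intro x hx
  have hxU := dv_subset_of_subset_dv hpU hx
  rw [← (isTIdeal_iff_s4.1 hp).2]
  exact ⟨⟨x, dv_subset (iset_subset _) hx⟩, ⟨_, hU, hxU⟩, rfl⟩

theorem isHDomain_of_tInv_of_isTMax (h : ∀ p : Ideal D, IsTMax D p → TInv D p) :
    IsHDomain D := by
  intro I h0 hv
  rw [tInv_iff h0]
  by_contra hne
  set S := setMul (dinv (D : Set F) (iset D I)) (iset D I)
  have hI : I ≤ tIdeal D S := fun x hx =>
    mem_tIdeal_of_mem ⟨1, fun z hz => by simpa using iset_subset _ hz, x, ⟨x, hx, rfl⟩, by simp⟩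
  obtain ⟨p, hp, hSp⟩ := exists_isTMax_le (ne_bot_of_le_ne_bot h0 hI) (by rwa [tIdeal_tIdeal])
  have hS : S ⊆ iset D p := fun x hx =>
    ⟨⟨x, setMul_dinv_subset _ hx⟩, hSp (mem_tIdeal_of_mem hx), rfl⟩
  obtain ⟨x, hx, hx1⟩ := hp.2.1.dv_iset_subset (h p hp) (dv_mono hS (one_mem_dv.2 (vInv_iff.1 hv)))
  obtain rfl : x = 1 := Subtype.ext hx1
  exact hp.1 ((Ideal.eq_top_iff_one p).2 hx)

/-- The ideal `D ∩ x⁻¹D` of denominators of `x`. -/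
def denomIdeal (D : Subring F) (x : F) : Ideal D where
  carrier := {d | (d : F) * x ∈ D}
  zero_mem' := by simp
  add_mem' := fun ha hb => by
    simpa [add_mul] using D.add_mem ha hb
  smul_mem' := fun c a ha => by
    simpa [mul_assoc] using D.mul_mem c.2 ha

theorem mem_denomIdeal {x : F} {d : D} : d ∈ denomIdeal D x ↔ (d : F) * x ∈ D := Iff.rfl

theorem isTIdeal_denomIdeal {x : F} (h : denomIdeal D x ≠ ⊥) :
    IsTIdeal D (iset D (denomIdeal D x)) := by
  refine isTIdeal_iff_s4.2 ⟨h, le_antisymm ?_ fun y hy => mem_tIdeal_of_mem (Set.mem_image_of_mem _ hy)⟩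
  rintro y ⟨T, hT, hy⟩
  refine hy x fun t ht => ?_
  obtain ⟨d, hd, rfl⟩ := hT ht
  rw [mul_comm]
  exact hd

theorem tInv_denomIdeal (hqf : IsQuotField D) (hD : IsPVMD D) (x : F) :
    TInv D (denomIdeal D x) := by
  obtain ⟨a, b, hb, hab⟩ := hqf x
  have hI0 : Ideal.span {a, b} ≠ ⊥ := fun h =>
    hb (by simpa [h] using Ideal.subset_span (s := {a, b}) (by simp : b ∈ ({a, b} : Set D)))
  have h0 : denomIdeal D x ≠ ⊥ :=
    (Submodule.ne_bot_iff _).2 ⟨b, mem_denomIdeal.2 (hab ▸ a.2), hb⟩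
  have hI := (tInv_iff hI0).1 (hD _ hI0 (Submodule.fg_span (Set.toFinite _)))
  rw [tInv_iff h0, ← top_le_iff, ← hI]
  refine tIdeal_mono ?_
  rintro _ ⟨z, hz, _, ⟨y, hy, rfl⟩, rfl⟩
  obtain ⟨r, s, rfl⟩ := Ideal.mem_span_pair.1 hy
  have hza : z * a ∈ D := hz _ ⟨a, Ideal.subset_span (by simp), rfl⟩
  have hzb : z * b ∈ D := hz _ ⟨b, Ideal.subset_span (by simp), rfl⟩
  refine ⟨r * x + s, ?_, z * b, ⟨⟨z * b, hzb⟩, ?_, rfl⟩, ?_⟩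
  · rintro _ ⟨d, hd, rfl⟩
    rw [show (r * x + s) * (d : F) = r * (d * x) + s * d by ring]
    exact D.add_mem (D.mul_mem r.2 hd) (D.mul_mem s.2 d.2)
  · rw [SetLike.mem_coe, mem_denomIdeal, mul_assoc, hab]
    exact hza
  · push_cast
    rw [← hab]
    ring

theorem IsTMax.tInv (hqf : IsQuotField D) (hD : IsPVMD D) (hH : IsHDomain D) {p : Ideal D}
    (hp : IsTMax D p) : TInv D p := by
  have h0 : p ≠ ⊥ := hp.2.1.ne_bot
  by_cases h : dinv (D : Set F) (iset D p) ⊆ D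
  · refine hH p h0 (vInv_iff.2 ((dinv_anti fun y hy => ?_).trans h))
    exact ⟨1, fun z hz => by simpa using iset_subset _ hz, y, hy, (one_mul y).symm⟩
  · obtain ⟨x, hx, hxD⟩ := Set.not_subset.1 h
    have hle : p ≤ denomIdeal D x := fun d hd => by
      rw [mem_denomIdeal, mul_comm]
      exact hx _ ⟨d, hd, rfl⟩
    have htop : denomIdeal D x ≠ ⊤ := fun h =>
      hxD (by simpa [mem_denomIdeal] using (Ideal.eq_top_iff_one _).1 h)
    rw [hp.2.2 _ htop (isTIdeal_denomIdeal (ne_bot_of_le_ne_bot h0 hle)) hle]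
    exact tInv_denomIdeal hqf hD x

end IVP

/-- A PVMD `D` is an H domain if and only if every t-maximal ideal of
`D` is t-invertible. -/
theorem stmt_4 (F : Type) [Field F] (D : Subring F)
    (hqf : IsQuotField D) (hne : (↑D : Set F) ≠ Set.univ)
    (hPVMD : IsPVMD D) :
    IsHDomain D ↔ ∀ p : Ideal ↥D, IsTMax D p → TInv D p :=
  ⟨fun hH _ hp => hp.tInv hqf hPVMD hH, isHDomain_of_tInv_of_isTMax⟩
end
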